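/- arXiv:2305.05127 — 2 statements merged into one kernel-verified Lean document; each statement's English description precedes it below -/
import Mathlib

section
/- Let d ≥ 1, let U : (0,∞) → ℝ be a C¹ convex function such that the function Ũ_d(z) := U(z^{-d})·z^d is convex and non-increasing on (0,∞). Let A and B be positive definite real d×d matrices and let c > 0. Then the function r : [0,1] → ℝ defined by r(t) := U( c / det((1−t)A + tB) ) · det((1−t)A + tB) is convex on [0,1]. (Note that (1−t)A + tB is positive definite for every t ∈ [0,1], so its determinant is positive and r is well defined.) -/
/-- Superadditivity of the geometric mean, for `a = 1`. -/
theorem Real.one_add_prod_rpow_le_prod_one_add_rpow {ι : Type*} [Fintype ι] [Nonempty ι]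
    {x : ι → ℝ} (hx : ∀ i, 0 ≤ x i) :
    1 + (∏ i, x i) ^ (1 / (Fintype.card ι : ℝ)) ≤
      (∏ i, (1 + x i)) ^ (1 / (Fintype.card ι : ℝ)) := by
  set w : ℝ := 1 / (Fintype.card ι : ℝ) with hw
  have hw0 : 0 ≤ w := by positivity
  have hcard : (Fintype.card ι : ℝ) ≠ 0 := Nat.cast_ne_zero.2 Fintype.card_ne_zero
  have hsum : ∑ _i : ι, w = 1 := by simp [hw, hcard]
  have hpos : ∀ i, 0 < 1 + x i := fun i => by linarith [hx i]
  have amgm : ∀ z : ι → ℝ, (∀ i, 0 ≤ z i) → (∏ i, z i) ^ w ≤ ∑ i, w * z i := fun z hz => by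
    rw [← Real.finsetProd_rpow _ _ fun i _ => hz i]
    exact Real.geom_mean_le_arith_mean_weighted _ (fun _ => w) z (fun _ _ => hw0) hsum
      fun i _ => hz i
  have h₁ := amgm (fun i => 1 / (1 + x i)) fun i => (one_div_pos.2 (hpos i)).le
  have h₂ := amgm (fun i => x i / (1 + x i)) fun i => div_nonneg (hx i) (hpos i).le
  have hP : 0 < ∏ i, (1 + x i) := Finset.prod_pos fun i _ => hpos i
  have hadd : (∑ i, w * (1 / (1 + x i))) + ∑ i, w * (x i / (1 + x i)) = 1 := by
    rw [← Finset.sum_add_distrib]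
    refine (Finset.sum_congr rfl fun i _ => ?_).trans hsum
    have := (hpos i).ne'
    field_simp
  rw [Finset.prod_div_distrib, Finset.prod_const_one,
    Real.div_rpow zero_le_one hP.le, Real.one_rpow] at h₁
  rw [Finset.prod_div_distrib,
    Real.div_rpow (Finset.prod_nonneg fun i _ => hx i) hP.le] at h₂
  rw [← div_le_one (Real.rpow_pos_of_pos hP w), add_div]
  linarith

namespace Matrix

theorem convex_posDef {n : Type*} : Convex ℝ {M : Matrix n n ℝ | M.PosDef} :=
  convex_iff_forall_pos.2 fun _ hA _ hB _ _ ha hb _ => (PosDef.smul hA ha).add (PosDef.smul hB hb)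

variable {n : Type*} [Fintype n] [DecidableEq n]

theorem IsHermitian.det_one_add {M : Matrix n n ℝ} (hM : M.IsHermitian) :
    (1 + M).det = ∏ i, (1 + hM.eigenvalues i) := by
  have h := M.eval_charpoly (-1)
  rw [hM.charpoly_eq, Polynomial.eval_prod, map_neg, map_one,
    show (-1 - M : Matrix n n ℝ) = -(1 + M) by abel, det_neg] at h
  have h' : ∀ i, Polynomial.eval (-1)
      (Polynomial.X - Polynomial.C ((RCLike.ofReal (hM.eigenvalues i) : ℝ))) =
      (-1) * (1 + hM.eigenvalues i) := fun i => by simp; ring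
  simp only [h', Finset.prod_mul_distrib, Finset.prod_const, Finset.card_univ] at h
  exact (mul_left_cancel₀ (pow_ne_zero _ (by norm_num)) h).symm

/-- **Minkowski's determinant inequality** for positive definite matrices. -/
theorem PosDef.det_rpow_add_le [Nonempty n] {A B : Matrix n n ℝ} (hA : A.PosDef)
    (hB : B.PosDef) :
    A.det ^ (1 / (Fintype.card n : ℝ)) + B.det ^ (1 / (Fintype.card n : ℝ)) ≤
      (A + B).det ^ (1 / (Fintype.card n : ℝ)) := by
  open scoped MatrixOrder in
  obtain ⟨C, hC⟩ := CStarAlgebra.nonneg_iff_eq_star_mul_self.mp hA.posSemidef.nonneg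
  rw [star_eq_conjTranspose] at hC
  have hdet : C.det ≠ 0 := fun h => hA.det_pos.ne' (by rw [hC, det_mul, h, mul_zero])
  have hCu : IsUnit C.det := isUnit_iff_ne_zero.2 hdet
  have hCu' : IsUnit Cᴴ.det := by simpa using hCu
  set D := (C⁻¹)ᴴ * B * C⁻¹ with hD
  have hDpos : D.PosSemidef := hB.posSemidef.conjTranspose_mul_mul_same _
  have hBD : B = Cᴴ * D * C := by
    rw [hD, conjTranspose_nonsing_inv]
    simp only [Matrix.mul_assoc, nonsing_inv_mul _ hCu, Matrix.mul_one]
    rw [← Matrix.mul_assoc, mul_nonsing_inv _ hCu', Matrix.one_mul]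
  have hABD : A + B = Cᴴ * (1 + D) * C := by
    rw [hC, hBD]; simp [Matrix.mul_add, Matrix.add_mul]
  have hdetB : B.det = A.det * ∏ i, hDpos.1.eigenvalues i := by
    rw [hBD, hC]; simp only [det_mul, hDpos.1.det_eq_prod_eigenvalues]; simp; ring
  have hdetAB : (A + B).det = A.det * ∏ i, (1 + hDpos.1.eigenvalues i) := by
    rw [hABD, hC]; simp only [det_mul, hDpos.1.det_one_add]; ring
  have hnn := hDpos.eigenvalues_nonneg
  rw [hdetB, hdetAB, Real.mul_rpow hA.det_pos.le (Finset.prod_nonneg fun i _ => hnn i),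
    Real.mul_rpow hA.det_pos.le (Finset.prod_nonneg fun i _ => by linarith [hnn i])]
  have := mul_le_mul_of_nonneg_left (Real.one_add_prod_rpow_le_prod_one_add_rpow hnn)
    (Real.rpow_nonneg hA.det_pos.le (1 / (Fintype.card n : ℝ)))
  linarith

theorem concaveOn_det_rpow [Nonempty n] :
    ConcaveOn ℝ {M : Matrix n n ℝ | M.PosDef}
      fun M => M.det ^ (1 / (Fintype.card n : ℝ)) := by
  refine concaveOn_iff_forall_pos.2 ⟨convex_posDef, fun A hA B hB a b ha hb _ => ?_⟩
  have hsmul : ∀ (M : Matrix n n ℝ) (s : ℝ), M.PosDef → 0 < s →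
      (s • M).det ^ (1 / (Fintype.card n : ℝ)) = s • M.det ^ (1 / (Fintype.card n : ℝ)) :=
    fun M s hM hs => by
      rw [det_smul, Real.mul_rpow (by positivity) hM.det_pos.le, one_div,
        Real.pow_rpow_inv_natCast hs.le Fintype.card_ne_zero, smul_eq_mul]
  have h := PosDef.det_rpow_add_le (PosDef.smul hA ha) (PosDef.smul hB hb)
  rwa [hsmul A a hA ha, hsmul B b hB hb] at h

end Matrix

/-- pointwise convexity claim inside Theorem 4.2: if `U` is C¹ and
convex on `(0,∞)` and `Ũ_d(z) = U(z^{-d})·z^d` is convex and non-increasing on `(0,∞)`,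
then for positive definite matrices `A, B` and `c > 0` the function
`r(t) = U(c / det((1−t)A + tB)) · det((1−t)A + tB)` is convex on `[0,1]`. -/
theorem internal_energy_pointwise_convex {d : ℕ} (hd : 1 ≤ d)
    (U : ℝ → ℝ)
    (hUC1 : ContDiffOn ℝ 1 U (Set.Ioi (0:ℝ)))
    (hUconv : ConvexOn ℝ (Set.Ioi (0:ℝ)) U)
    (hUdconv : ConvexOn ℝ (Set.Ioi (0:ℝ)) (fun z : ℝ => U (z ^ (-(d:ℤ))) * z ^ (d:ℕ)))
    (hUdmono : AntitoneOn (fun z : ℝ => U (z ^ (-(d:ℤ))) * z ^ (d:ℕ)) (Set.Ioi (0:ℝ)))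
    (A B : Matrix (Fin d) (Fin d) ℝ) (hA : A.PosDef) (hB : B.PosDef)
    (c : ℝ) (hc : 0 < c) :
    ConvexOn ℝ (Set.Icc (0:ℝ) 1)
      (fun t : ℝ => U (c / ((1-t) • A + t • B).det) * ((1-t) • A + t • B).det) := by
  have hd0 : d ≠ 0 := by omega
  have : Nonempty (Fin d) := ⟨⟨0, hd⟩⟩
  set M : ℝ → Matrix (Fin d) (Fin d) ℝ := fun t => (1 - t) • A + t • B with hM
  set f : ℝ → ℝ := fun z => U (z ^ (-(d:ℤ))) * z ^ (d:ℕ) with hf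
  set k : ℝ := c ^ (-(1 / (d : ℝ))) with hk
  have hk0 : 0 < k := Real.rpow_pos_of_pos hc _
  set z : ℝ → ℝ := fun t => k * (M t).det ^ (1 / (d : ℝ)) with hz
  have hMpos : ∀ t ∈ Set.Icc (0:ℝ) 1, (M t).PosDef := fun t ht =>
    Matrix.convex_posDef hA hB (by linarith [ht.2]) ht.1 (by ring)
  have hz0 : ∀ t ∈ Set.Icc (0:ℝ) 1, 0 < z t := fun t ht =>
    mul_pos hk0 (Real.rpow_pos_of_pos (hMpos t ht).det_pos _)
  have hzpow : ∀ t ∈ Set.Icc (0:ℝ) 1, z t ^ d = (M t).det / c := fun t ht => by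
    rw [hz, mul_pow, hk, Real.rpow_neg hc.le, inv_pow, one_div,
      Real.rpow_inv_natCast_pow hc.le hd0,
      Real.rpow_inv_natCast_pow (hMpos t ht).det_pos.le hd0, div_eq_inv_mul]
  have hr : ∀ t ∈ Set.Icc (0:ℝ) 1, U (c / (M t).det) * (M t).det = c * f (z t) := fun t ht => by
    rw [hf]
    simp only [zpow_neg, zpow_natCast, hzpow t ht, inv_div]
    field_simp
  have hconc : ConcaveOn ℝ (Set.Icc (0:ℝ) 1) z := by
    refine ⟨convex_Icc 0 1, fun x hx y hy a b ha hb hab => ?_⟩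
    have h := Matrix.concaveOn_det_rpow.2 (hMpos x hx) (hMpos y hy) ha hb hab
    have hMab : a • M x + b • M y = M (a • x + b • y) := by
      obtain rfl : a = 1 - b := by linarith
      simp only [hM, smul_eq_mul]
      module
    rw [hMab, Fintype.card_fin] at h
    have := mul_le_mul_of_nonneg_left h hk0.le
    simp only [hz, smul_eq_mul] at this ⊢
    linarith
  refine ⟨convex_Icc 0 1, fun x hx y hy a b ha hb hab => ?_⟩
  have hxy := convex_Icc (0:ℝ) 1 hx hy ha hb hab
  have hzxy := convex_Ioi (0:ℝ) (hz0 x hx) (hz0 y hy) ha hb hab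
  change U (c / (M _).det) * (M _).det ≤
    a • (U (c / (M x).det) * (M x).det) + b • (U (c / (M y).det) * (M y).det)
  rw [hr _ hxy, hr x hx, hr y hy]
  calc c * f (z (a • x + b • y)) ≤ c * f (a • z x + b • z y) := by
        gcongr
        exact hUdmono hzxy (hz0 _ hxy) (hconc.2 hx hy ha hb hab)
    _ ≤ c * (a • f (z x) + b • f (z y)) := by
        gcongr
        exact hUdconv.2 (hz0 x hx) (hz0 y hy) ha hb hab
    _ = a • (c * f (z x)) + b • (c * f (z y)) := by simp only [smul_eq_mul]; ring
end

section
/- Let d ≥ 1, let U : (0,∞) → ℝ be a C¹ convex function such that Ũ_d(z) := U(z^{-d})·z^d is convex and non-increasing on (0,∞), let A and B be positive definite real d×d matrices, and let c > 0. Then U( c / det B )·det B − U( c / det A )·det A ≥ G · tr( A⁻¹ (B − A) ), where G := −U′( c / det A )·c + U( c / det A )·det A and tr denotes the matrix trace. -/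
open scoped MatrixOrder in
/-- The trace and determinant form of the AM-GM inequality for the product of a positive
semidefinite matrix with another one. -/
theorem Matrix.PosSemidef.det_mul_rpow_le_trace_mul {n : Type*} [Fintype n] [DecidableEq n]
    [Nonempty n] {P Q : Matrix n n ℝ} (hP : P.PosSemidef) (hQ : Q.PosSemidef) :
    (P * Q).det ^ ((Fintype.card n : ℝ)⁻¹) ≤ (P * Q).trace / Fintype.card n := by
  obtain ⟨R, rfl⟩ := CStarAlgebra.nonneg_iff_eq_star_mul_self.mp hP.nonneg
  rw [Matrix.star_eq_conjTranspose]
  have hS := hQ.mul_mul_conjTranspose_same R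
  have hdet : (R.conjTranspose * R * Q).det = (R * Q * R.conjTranspose).det := by
    simp only [Matrix.det_mul]
    ring
  have htr : (R.conjTranspose * R * Q).trace = (R * Q * R.conjTranspose).trace := by
    rw [Matrix.mul_assoc, Matrix.trace_mul_comm]
  rw [hdet, htr, hS.isHermitian.det_eq_prod_eigenvalues, hS.isHermitian.trace_eq_sum_eigenvalues]
  simpa using Real.geom_mean_le_arith_mean Finset.univ (fun _ : n => (1 : ℝ))
    hS.isHermitian.eigenvalues (fun _ _ => zero_le_one) (by simp [Fintype.card_pos])
    (fun i _ => hS.eigenvalues_nonneg i)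

/-- A convex function lies above its tangent lines. -/
theorem ConvexOn.add_mul_sub_le_of_hasDerivAt {s : Set ℝ} {f : ℝ → ℝ} {f' x y : ℝ}
    (hf : ConvexOn ℝ s f) (hx : x ∈ s) (hy : y ∈ s) (hf' : HasDerivAt f f' x) :
    f x + f' * (y - x) ≤ f y := by
  rcases lt_trichotomy x y with h | rfl | h
  · have := hf.le_slope_of_hasDerivAt hx hy h hf'
    rw [slope_def_field, le_div_iff₀ (sub_pos.2 h)] at this
    linarith
  · simp
  · have := hf.slope_le_of_hasDerivAt hy hx h hf'
    rw [slope_def_field, div_le_iff₀ (sub_pos.2 h)] at this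
    linarith

/-- The derivative of the dilated energy density `z ↦ U (z⁻ᵈ) zᵈ`. -/
theorem hasDerivAt_comp_zpow_neg_mul_pow {d : ℕ} {U : ℝ → ℝ} {z : ℝ} (hz : 0 < z)
    (hU : DifferentiableAt ℝ U (z ^ (-(d : ℤ)))) :
    HasDerivAt (fun z : ℝ => U (z ^ (-(d : ℤ))) * z ^ d)
      (d / z * (U (z ^ (-(d : ℤ))) * z ^ d - deriv U (z ^ (-(d : ℤ))))) z := by
  have h := (hU.hasDerivAt.comp z (hasDerivAt_zpow (-(d : ℤ)) z (Or.inl hz.ne'))).mul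
    (hasDerivAt_pow d z)
  refine h.congr_deriv ?_
  have h1 : z ^ (-(d : ℤ) - 1) * z ^ d = z⁻¹ := by
    rw [← zpow_natCast z d, ← zpow_add₀ hz.ne', ← zpow_neg_one]
    congr 1
    ring
  have h2 : (d : ℝ) * z ^ (d - 1) = d / z * z ^ d := by
    rcases d with _ | k
    · simp
    · rw [Nat.add_sub_cancel, pow_succ]
      field_simp
  rw [Function.comp_apply, h2]
  push_cast
  linear_combination (-(d : ℝ)) * deriv U (z ^ (-(d : ℤ))) * h1

/-- pointwise gradient inequality inside Theorem 4.2: for `U` C¹ and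
convex on `(0,∞)` with `Ũ_d(z) = U(z^{-d})·z^d` convex and non-increasing on `(0,∞)`,
positive definite `A, B`, and `c > 0`,
`U(c/det B)·det B − U(c/det A)·det A ≥ G · tr(A⁻¹(B − A))` where
`G = −U′(c/det A)·c + U(c/det A)·det A`. -/
theorem internal_energy_pointwise_gradient_ineq {d : ℕ} (hd : 1 ≤ d)
    (U : ℝ → ℝ)
    (hUC1 : ContDiffOn ℝ 1 U (Set.Ioi (0:ℝ)))
    (hUconv : ConvexOn ℝ (Set.Ioi (0:ℝ)) U)
    (hUdconv : ConvexOn ℝ (Set.Ioi (0:ℝ)) (fun z : ℝ => U (z ^ (-(d:ℤ))) * z ^ (d:ℕ)))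
    (hUdmono : AntitoneOn (fun z : ℝ => U (z ^ (-(d:ℤ))) * z ^ (d:ℕ)) (Set.Ioi (0:ℝ)))
    (A B : Matrix (Fin d) (Fin d) ℝ) (hA : A.PosDef) (hB : B.PosDef)
    (c : ℝ) (hc : 0 < c) :
    U (c / B.det) * B.det - U (c / A.det) * A.det ≥
      (-(deriv U (c / A.det)) * c + U (c / A.det) * A.det) * (A⁻¹ * (B - A)).trace := by

  have : NeZero d := ⟨by omega⟩
  have hd0 : (0 : ℝ) < d := by exact_mod_cast hd
  have hdA := hA.det_pos
  have hdB := hB.det_pos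
  have root (x : ℝ) (hx : 0 < x) : ((x / c) ^ ((d : ℝ)⁻¹)) ^ d = x / c :=
    Real.rpow_inv_natCast_pow (div_pos hx hc).le (by omega)
  have inv_root (x : ℝ) (hx : 0 < x) : ((x / c) ^ ((d : ℝ)⁻¹)) ^ (-(d : ℤ)) = c / x := by
    rw [zpow_neg, zpow_natCast, root x hx, inv_div]
  set z := (A.det / c) ^ ((d : ℝ)⁻¹) with hz
  set w := (B.det / c) ^ ((d : ℝ)⁻¹) with hw
  have hz0 : 0 < z := Real.rpow_pos_of_pos (div_pos hdA hc) _
  have hw0 : 0 < w := Real.rpow_pos_of_pos (div_pos hdB hc) _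
  have hzU : z ^ (-(d : ℤ)) = c / A.det := inv_root _ hdA
  have hwU : w ^ (-(d : ℤ)) = c / B.det := inv_root _ hdB
  have hUd : DifferentiableAt ℝ U (z ^ (-(d : ℤ))) :=
    (hUC1.differentiableOn one_ne_zero).differentiableAt (Ioi_mem_nhds (zpow_pos hz0 _))
  have hφ := hasDerivAt_comp_zpow_neg_mul_pow hz0 hUd
  have htangent := hUdconv.add_mul_sub_le_of_hasDerivAt (Set.mem_Ioi.2 hz0) (Set.mem_Ioi.2 hw0) hφ
  have hneg := hUdmono.derivWithin_nonpos (x := z)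
  rw [hφ.hasDerivWithinAt.derivWithin (isOpen_Ioi.uniqueDiffWithinAt hz0)] at hneg
  have hamgm := hA.inv.posSemidef.det_mul_rpow_le_trace_mul hB.posSemidef
  have htr : (A⁻¹ * (B - A)).trace = (A⁻¹ * B).trace - d := by
    rw [Matrix.mul_sub, Matrix.nonsing_inv_mul _ hdA.ne'.isUnit, Matrix.trace_sub,
      Matrix.trace_one, Fintype.card_fin]
  have hratio : (A⁻¹ * B).det ^ ((d : ℝ)⁻¹) = w / z := by
    rw [hw, hz, ← Real.div_rpow (div_pos hdB hc).le (div_pos hdA hc).le, Matrix.det_mul,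
      Matrix.det_nonsing_inv, Ring.inverse_eq_inv']
    congr 1
    field_simp
  rw [Fintype.card_fin, hratio, div_le_div_iff₀ hz0 hd0] at hamgm
  simp only [hzU, hwU, root _ hdA, root _ hdB, z, w] at htangent hneg
  set K := U (c / A.det) * (A.det / c) - deriv U (c / A.det) with hK
  have hdw : w - z ≤ z / d * (A⁻¹ * (B - A)).trace := by
    rw [htr, div_mul_eq_mul_div, le_div_iff₀ hd0]
    linarith
  have hmul := mul_le_mul_of_nonpos_left hdw hneg
  have hcancel : d / z * K * (z / d * (A⁻¹ * (B - A)).trace) = K * (A⁻¹ * (B - A)).trace := by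
    field_simp
  have hmain := mul_le_mul_of_nonneg_left (hcancel.symm.le.trans hmul |>.trans
    (le_sub_iff_add_le'.2 htangent)) hc.le
  have hKc : c * K = -(deriv U (c / A.det)) * c + U (c / A.det) * A.det := by
    rw [hK]
    field_simp
    ring
  rw [ge_iff_le, ← hKc, mul_assoc]
  refine hmain.trans_eq ?_
  field_simp
end
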